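/- Suppose Ŷ is poised for quadratic interpolation of f̂, with unique interpolant coefficients (ĝ, Ĥ). Then the full-space MN problem is feasible and its unique minimizer is (Q ĝ, Q Ĥ Qᵀ). -/

import Mathlib

open Matrix

/-- Squared Frobenius norm of a real matrix. -/
noncomputable def frobSq {a b : ℕ} (A : Matrix (Fin a) (Fin b) ℝ) : ℝ :=
  ∑ i, ∑ j, (A i j) ^ 2

/-- Squared Euclidean norm of a real vector. -/
noncomputable def vecNormSq {a : ℕ} (v : Fin a → ℝ) : ℝ :=
  ∑ i, (v i) ^ 2

/-- `v` lies in the orthogonal complement of the column space of `Q`. -/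
def inColPerp {n d : ℕ} (Q : Matrix (Fin n) (Fin d) ℝ) (v : Fin n → ℝ) : Prop :=
  ∀ u : Fin d → ℝ, Q.mulVec u ⬝ᵥ v = 0

/-- Feasibility for the quadratic interpolation constraints: `p = (α, H)` with `H`
symmetric and `(dᵢ)ᵀ α + ½ (dᵢ)ᵀ H dᵢ = rhs i` for all `i`. -/
def QFeas {k m : ℕ} (dd : Fin m → Fin k → ℝ) (rhs : Fin m → ℝ)
    (p : (Fin k → ℝ) × Matrix (Fin k) (Fin k) ℝ) : Prop :=
  p.2.IsSymm ∧ ∀ i, dd i ⬝ᵥ p.1 + (1 / 2) * (dd i ⬝ᵥ p.2.mulVec (dd i)) = rhs i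

/-- Objective of the minimum norm (MN) problem. -/
noncomputable def MNObj {k : ℕ} (p : (Fin k → ℝ) × Matrix (Fin k) (Fin k) ℝ) : ℝ :=
  (1 / 2) * vecNormSq p.1 + (1 / 2) * frobSq p.2

/-- `p` is a minimizer of the MN problem. -/
def MNMin {k m : ℕ} (dd : Fin m → Fin k → ℝ) (rhs : Fin m → ℝ)
    (p : (Fin k → ℝ) × Matrix (Fin k) (Fin k) ℝ) : Prop :=
  QFeas dd rhs p ∧ ∀ q, QFeas dd rhs q → MNObj p ≤ MNObj q

/-- Objective of the minimum Frobenius norm (MFN) problem. -/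
noncomputable def MFNObj {k : ℕ} (p : (Fin k → ℝ) × Matrix (Fin k) (Fin k) ℝ) : ℝ :=
  (1 / 2) * frobSq p.2

/-- `p` is a minimizer of the MFN problem. -/
def MFNMin {k m : ℕ} (dd : Fin m → Fin k → ℝ) (rhs : Fin m → ℝ)
    (p : (Fin k → ℝ) × Matrix (Fin k) (Fin k) ℝ) : Prop :=
  QFeas dd rhs p ∧ ∀ q, QFeas dd rhs q → MFNObj p ≤ MFNObj q

/-- Objective of the least Frobenius norm updating (LFU) problem. -/
noncomputable def LFUObj {k : ℕ} (Hbar : Matrix (Fin k) (Fin k) ℝ)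
    (p : (Fin k → ℝ) × Matrix (Fin k) (Fin k) ℝ) : ℝ :=
  (1 / 2) * frobSq (p.2 - Hbar)

/-- `p` is a minimizer of the LFU problem with reference matrix `Hbar`. -/
def LFUMin {k m : ℕ} (dd : Fin m → Fin k → ℝ) (rhs : Fin m → ℝ)
    (Hbar : Matrix (Fin k) (Fin k) ℝ)
    (p : (Fin k → ℝ) × Matrix (Fin k) (Fin k) ℝ) : Prop :=
  QFeas dd rhs p ∧ ∀ q, QFeas dd rhs q → LFUObj Hbar p ≤ LFUObj Hbar q

/-- `X` is a Moore–Penrose pseudoinverse of `A`. -/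
def IsMPInv {a b : ℕ} (A : Matrix (Fin a) (Fin b) ℝ) (X : Matrix (Fin b) (Fin a) ℝ) : Prop :=
  A * X * A = A ∧ X * A * X = X ∧ (A * X)ᵀ = A * X ∧ (X * A)ᵀ = X * A

/-- The vector `δ_g(y⁰; W)` with `i`-th entry `g(y⁰ + wⁱ) − g(y⁰)`,
where `wⁱ` is the `i`-th column of `W`. -/
noncomputable def deltaVec {k p : ℕ} (g : (Fin k → ℝ) → ℝ) (y0 : Fin k → ℝ)
    (W : Matrix (Fin k) (Fin p) ℝ) : Fin p → ℝ :=
  fun i => g (y0 + fun j => W j i) - g y0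

theorem vecNormSq_eq_dotProduct {a : ℕ} (v : Fin a → ℝ) : vecNormSq v = v ⬝ᵥ v := by
  simp only [vecNormSq, dotProduct, pow_two]

theorem frobSq_eq_trace {a b : ℕ} (A : Matrix (Fin a) (Fin b) ℝ) :
    frobSq A = (Aᵀ * A).trace := by
  simp only [frobSq, trace, diag_apply, mul_apply, transpose_apply, pow_two]
  exact Finset.sum_comm

theorem vecNormSq_nonneg {a : ℕ} (v : Fin a → ℝ) : 0 ≤ vecNormSq v :=
  Finset.sum_nonneg fun _ _ => sq_nonneg _

theorem frobSq_nonneg {a b : ℕ} (A : Matrix (Fin a) (Fin b) ℝ) : 0 ≤ frobSq A :=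
  Finset.sum_nonneg fun _ _ => Finset.sum_nonneg fun _ _ => sq_nonneg _

theorem MNObj_nonneg {k : ℕ} (p : (Fin k → ℝ) × Matrix (Fin k) (Fin k) ℝ) : 0 ≤ MNObj p := by
  have h₁ := vecNormSq_nonneg p.1
  have h₂ := frobSq_nonneg p.2
  unfold MNObj
  positivity

theorem eq_zero_of_vecNormSq_eq_zero {a : ℕ} {v : Fin a → ℝ} (h : vecNormSq v = 0) : v = 0 := by
  rwa [vecNormSq_eq_dotProduct, dotProduct_self_eq_zero] at h

theorem eq_zero_of_frobSq_eq_zero {a b : ℕ} {A : Matrix (Fin a) (Fin b) ℝ}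
    (h : frobSq A = 0) : A = 0 := by
  ext i j
  have hi := (Finset.sum_eq_zero_iff_of_nonneg
    fun i _ => Finset.sum_nonneg fun j _ => sq_nonneg (A i j)).1 h i (Finset.mem_univ i)
  have hij := (Finset.sum_eq_zero_iff_of_nonneg
    fun j _ => sq_nonneg (A i j)).1 hi j (Finset.mem_univ j)
  simpa using hij

theorem eq_zero_of_MNObj_nonpos {k : ℕ} {p : (Fin k → ℝ) × Matrix (Fin k) (Fin k) ℝ}
    (h : MNObj p ≤ 0) : p = 0 := by
  have h₁ := vecNormSq_nonneg p.1
  have h₂ := frobSq_nonneg p.2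
  unfold MNObj at h
  exact Prod.ext (eq_zero_of_vecNormSq_eq_zero (by linarith))
    (eq_zero_of_frobSq_eq_zero (by linarith))

/-- Pythagoras for the projection of a vector onto the column space of `Q`. -/
theorem vecNormSq_eq_add {n d : ℕ} {Q : Matrix (Fin n) (Fin d) ℝ} (hQ : Qᵀ * Q = 1)
    {α : Fin n → ℝ} {g : Fin d → ℝ} (hα : Qᵀ *ᵥ α = g) :
    vecNormSq α = vecNormSq (Q *ᵥ g) + vecNormSq (α - Q *ᵥ g) := by
  have h (v : Fin n → ℝ) : Q *ᵥ g ⬝ᵥ v = g ⬝ᵥ Qᵀ *ᵥ v := by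
    rw [dotProduct_mulVec, vecMul_transpose]
  have hperp : Q *ᵥ g ⬝ᵥ α = Q *ᵥ g ⬝ᵥ Q *ᵥ g := by
    rw [h, h, hα, mulVec_mulVec, hQ, one_mulVec]
  simp only [vecNormSq_eq_dotProduct, sub_dotProduct, dotProduct_sub,
    dotProduct_comm α (Q *ᵥ g), hperp]
  ring

theorem transpose_mul_conj_mul {n d : ℕ} {Q : Matrix (Fin n) (Fin d) ℝ} (hQ : Qᵀ * Q = 1)
    (K : Matrix (Fin d) (Fin d) ℝ) : Qᵀ * (Q * K * Qᵀ) * Q = K := by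
  rw [show Qᵀ * (Q * K * Qᵀ) * Q = (Qᵀ * Q) * K * (Qᵀ * Q) by
    simp only [Matrix.mul_assoc], hQ, Matrix.one_mul, Matrix.mul_one]

/-- Pythagoras for the compression of a matrix to the column space of `Q`. -/
theorem frobSq_eq_add {n d : ℕ} {Q : Matrix (Fin n) (Fin d) ℝ} (hQ : Qᵀ * Q = 1)
    {H : Matrix (Fin n) (Fin n) ℝ} {K : Matrix (Fin d) (Fin d) ℝ} (hH : Qᵀ * H * Q = K) :
    frobSq H = frobSq (Q * K * Qᵀ) + frobSq (H - Q * K * Qᵀ) := by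
  have h (M : Matrix (Fin n) (Fin n) ℝ) :
      ((Q * K * Qᵀ)ᵀ * M).trace = (Kᵀ * (Qᵀ * M * Q)).trace := by
    rw [show (Q * K * Qᵀ)ᵀ * M = Q * (Kᵀ * (Qᵀ * M)) by
      simp only [transpose_mul, transpose_transpose, Matrix.mul_assoc], trace_mul_comm]
    simp only [Matrix.mul_assoc]
  have hperp : ((Q * K * Qᵀ)ᵀ * H).trace = ((Q * K * Qᵀ)ᵀ * (Q * K * Qᵀ)).trace := by
    rw [h, h, hH, transpose_mul_conj_mul hQ]
  have hsymm : (Hᵀ * (Q * K * Qᵀ)).trace = ((Q * K * Qᵀ)ᵀ * H).trace := by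
    rw [← trace_transpose, transpose_mul, transpose_transpose]
  simp only [frobSq_eq_trace, transpose_sub, Matrix.sub_mul, Matrix.mul_sub, trace_sub,
    hsymm, hperp]
  ring

theorem mulVec_dotProduct_mulVec {n d : ℕ} (Q : Matrix (Fin n) (Fin d) ℝ)
    (H : Matrix (Fin n) (Fin n) ℝ) (v : Fin d → ℝ) :
    Q *ᵥ v ⬝ᵥ H *ᵥ (Q *ᵥ v) = v ⬝ᵥ (Qᵀ * H * Q) *ᵥ v := by
  rw [← mulVec_mulVec, ← mulVec_mulVec, dotProduct_mulVec v, vecMul_transpose]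

/-- Interpolation along `col(Q)` only sees `Qᵀ α` and `Qᵀ H Q`. -/
theorem mulVec_constraint {n d : ℕ} (Q : Matrix (Fin n) (Fin d) ℝ) (α : Fin n → ℝ)
    (H : Matrix (Fin n) (Fin n) ℝ) (v : Fin d → ℝ) :
    Q *ᵥ v ⬝ᵥ α + (1 / 2) * (Q *ᵥ v ⬝ᵥ H *ᵥ (Q *ᵥ v)) =
      (Qᵀ *ᵥ α) ⬝ᵥ v + (1 / 2) * (v ⬝ᵥ (Qᵀ * H * Q) *ᵥ v) := by
  rw [mulVec_dotProduct_mulVec, dotProduct_comm (Qᵀ *ᵥ α),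
    dotProduct_mulVec v Qᵀ, vecMul_transpose]

/-- If `Ŷ` is poised for quadratic interpolation of `f̂` with unique
interpolant coefficients `(ĝ, Ĥ)`, then the full-space MN problem is feasible and
its unique minimizer is `(Q ĝ, Q Ĥ Qᵀ)`. -/
theorem stmt_2 {n d m : ℕ} (hn : 0 < n) (hd : 0 < d) (hm : 0 < m) (hdn : d < n)
    (Q : Matrix (Fin n) (Fin d) ℝ) (hQ : Qᵀ * Q = 1)
    (f : (Fin n → ℝ) → ℝ) (x0 : Fin n → ℝ) (dh : Fin m → Fin d → ℝ)
    (fh : (Fin d → ℝ) → ℝ) (hfh : ∀ xh, fh xh = f (x0 + Q.mulVec xh))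
    (gh : Fin d → ℝ) (Hh : Matrix (Fin d) (Fin d) ℝ) (hHhsymm : Hh.IsSymm)
    (hInterp : ∀ i, fh 0 + gh ⬝ᵥ dh i + (1 / 2) * (dh i ⬝ᵥ Hh.mulVec (dh i)) = fh (dh i))
    (hPoised : ∀ (g' : Fin d → ℝ) (H' : Matrix (Fin d) (Fin d) ℝ), H'.IsSymm →
      (∀ i, fh 0 + g' ⬝ᵥ dh i + (1 / 2) * (dh i ⬝ᵥ H'.mulVec (dh i)) = fh (dh i)) →
      g' = gh ∧ H' = Hh) :
    (∃ p, QFeas (fun i => Q.mulVec (dh i))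
      (fun i => f (x0 + Q.mulVec (dh i)) - f x0) p) ∧
    MNMin (fun i => Q.mulVec (dh i)) (fun i => f (x0 + Q.mulVec (dh i)) - f x0)
      (Q.mulVec gh, Q * Hh * Qᵀ) ∧
    (∀ p, MNMin (fun i => Q.mulVec (dh i)) (fun i => f (x0 + Q.mulVec (dh i)) - f x0) p →
      p = (Q.mulVec gh, Q * Hh * Qᵀ)) := by
  have hf0 : fh 0 = f x0 := by rw [hfh, mulVec_zero, add_zero]
  have hfeas : QFeas (fun i => Q.mulVec (dh i)) (fun i => f (x0 + Q.mulVec (dh i)) - f x0)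
      (Q.mulVec gh, Q * Hh * Qᵀ) := by
    refine ⟨?_, fun i => ?_⟩
    · simp only [IsSymm, transpose_mul, transpose_transpose, hHhsymm.eq, Matrix.mul_assoc]
    · have hi := hInterp i
      rw [hfh (dh i), hf0] at hi
      rw [mulVec_constraint, transpose_mul_conj_mul hQ, mulVec_mulVec, hQ, one_mulVec]
      linarith
  have hpyth : ∀ q, QFeas (fun i => Q.mulVec (dh i))
      (fun i => f (x0 + Q.mulVec (dh i)) - f x0) q →
      MNObj q = MNObj (Q.mulVec gh, Q * Hh * Qᵀ) +
        MNObj (q - (Q.mulVec gh, Q * Hh * Qᵀ)) := by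
    rintro ⟨α, H⟩ ⟨hsymm, hq⟩
    obtain ⟨hg, hH⟩ := hPoised (Qᵀ *ᵥ α) (Qᵀ * H * Q)
      (by
        simp only [IsSymm, transpose_mul, transpose_transpose, Matrix.mul_assoc]
        rw [hsymm.eq])
      (fun i => by
        have hi := hq i
        simp only [mulVec_constraint] at hi
        rw [hfh (dh i), hf0]
        linarith)
    simp only [MNObj, Prod.mk_sub_mk]
    rw [vecNormSq_eq_add hQ hg, frobSq_eq_add hQ hH]
    ring
  refine ⟨⟨_, hfeas⟩, ⟨hfeas, fun q hq => ?_⟩, fun p hp => ?_⟩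
  · have := MNObj_nonneg (q - (Q.mulVec gh, Q * Hh * Qᵀ))
    linarith [hpyth q hq]
  · have hle := hp.2 _ hfeas
    exact sub_eq_zero.1 (eq_zero_of_MNObj_nonpos (by linarith [hpyth p hp.1]))
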